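/- Let N ≥ 5 be an integer and let α be a real number with 0 < α < 2. Then there exists a constant S > 0 such that for every u ∈ C_c^∞(ℝ^N): ∫_{ℝ^N} |div(|x|^α ∇u)(x)|² dx ≥ S (∫_{ℝ^N} |u(x)|^{2**_α} dx)^{2/2**_α}. (A new second-order Caffarelli–Kohn–Nirenberg inequality.) -/

import Mathlib

open Real MeasureTheory Filter

noncomputable section

/-- Laplacian of a real-valued function on Euclidean space. -/
def lap {N : ℕ} (u : EuclideanSpace ℝ (Fin N) → ℝ) (x : EuclideanSpace ℝ (Fin N)) : ℝ :=
  ∑ i : Fin N, fderiv ℝ (fun y => fderiv ℝ u y (EuclideanSpace.single i 1)) x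
    (EuclideanSpace.single i 1)

/-- The weighted operator `div(|x|^α ∇u)(x) = |x|^α Δu(x) + α |x|^(α-2) (x · ∇u(x))`.
Note that `x · ∇u(x)` is the directional derivative of `u` at `x` along `x`. -/
def wOp {N : ℕ} (α : ℝ) (u : EuclideanSpace ℝ (Fin N) → ℝ) (x : EuclideanSpace ℝ (Fin N)) : ℝ :=
  ‖x‖ ^ α * lap u x + α * ‖x‖ ^ (α - 2) * fderiv ℝ u x x

/-- The constant `C_{N,α} = [(N−4+2α)(N−2+α)N(N+2−α)]^{(N−4+2α)/(8−4α)}`. -/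
def Cconst (N : ℕ) (α : ℝ) : ℝ :=
  (((N : ℝ) - 4 + 2*α) * ((N : ℝ) - 2 + α) * (N : ℝ) * ((N : ℝ) + 2 - α)) ^
    (((N : ℝ) - 4 + 2*α) / (8 - 4*α))

/-- The radial solution `U_{λ,α}(x) = C_{N,α} λ^{(N−4+2α)/2} (1+λ^{2−α}|x|^{2−α})^{−(N−4+2α)/(2−α)}`. -/
def Usol (N : ℕ) (α lam : ℝ) (x : EuclideanSpace ℝ (Fin N)) : ℝ :=
  Cconst N α * lam ^ (((N : ℝ) - 4 + 2*α)/2) *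
    (1 + lam ^ (2-α) * ‖x‖ ^ (2-α)) ^ (-(((N : ℝ) - 4 + 2*α)/(2-α)))

/-- The critical exponent `2**_α = 2N/(N-4+2α)`. -/
def pexp (N : ℕ) (α : ℝ) : ℝ := 2*(N : ℝ)/((N : ℝ) - 4 + 2*α)

/-- The constant `C(M) = (M−4)(M−2)M(M+2)(Γ(M/2)²/(2Γ(M)))^{4/M}`. -/
def CM (M : ℝ) : ℝ :=
  (M-4)*(M-2)*M*(M+2) * (Real.Gamma (M/2)^2 / (2*Real.Gamma M)) ^ ((4 : ℝ)/M)

/-- The sharp radial constant `S^{rad}_{N,α}`. -/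
def Srad (N : ℕ) (α : ℝ) : ℝ :=
  ((2-α)/2) ^ ((4 : ℝ) - (4-2*α)/(N : ℝ)) *
    (2 * Real.pi ^ ((N : ℝ)/2) / Real.Gamma ((N : ℝ)/2)) ^ ((4-2*α)/(N : ℝ)) *
    CM (2*(N : ℝ)/(2-α))

theorem integral_fderiv_apply_eq_zero {E : Type*} [NormedAddCommGroup E] [NormedSpace ℝ E]
    [FiniteDimensional ℝ E] [MeasurableSpace E] [BorelSpace E] (μ : Measure E)
    [μ.IsAddHaarMeasure] {g : E → ℝ} (hg : ContDiff ℝ 1 g) (hgs : HasCompactSupport g) (v : E) :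
    ∫ x, fderiv ℝ g x v ∂μ = 0 := by
  have hi : Integrable (fun x => fderiv ℝ g x v) μ :=
    ((hg.continuous_fderiv one_ne_zero).clm_apply continuous_const).integrable_of_hasCompactSupport
      (hgs.fderiv_apply (𝕜 := ℝ) v)
  have := integral_mul_fderiv_eq_neg_fderiv_mul_of_integrable (μ := μ) (f := fun _ : E => (1 : ℝ))
    (g := g) (v := v) (by simp) (by simpa using hi)
    (by simpa using hg.continuous.integrable_of_hasCompactSupport hgs) (by simp)
    (fun x _ => hg.differentiable one_ne_zero x)
  simpa using this

theorem EuclideanSpace.clm_apply_eq_sum {N : ℕ} (L : EuclideanSpace ℝ (Fin N) →L[ℝ] ℝ)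
    (x : EuclideanSpace ℝ (Fin N)) :
    L x = ∑ i, x i * L (EuclideanSpace.single i 1) := by
  conv_lhs => rw [← (EuclideanSpace.basisFun (Fin N) ℝ).sum_repr x]
  simp [map_sum]

theorem EuclideanSpace.sq_norm_clm_le_sum {N : ℕ} (L : EuclideanSpace ℝ (Fin N) →L[ℝ] ℝ) :
    ‖L‖ ^ 2 ≤ ∑ i, L (EuclideanSpace.single i 1) ^ 2 := by
  have h0 : 0 ≤ ∑ i, L (EuclideanSpace.single i (1 : ℝ)) ^ 2 :=
    Finset.sum_nonneg fun _ _ => sq_nonneg _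
  have h : ‖L‖ ≤ √(∑ i, L (EuclideanSpace.single i 1) ^ 2) := by
    refine L.opNorm_le_bound (Real.sqrt_nonneg _) fun x => ?_
    rw [EuclideanSpace.clm_apply_eq_sum L x, EuclideanSpace.norm_eq, ← Real.sqrt_mul h0,
      Real.norm_eq_abs]
    refine Real.abs_le_sqrt ?_
    simpa [mul_comm] using Finset.sum_mul_sq_le_sq_mul_sq Finset.univ (fun i => x i)
      (fun i => L (EuclideanSpace.single i (1 : ℝ)))
  calc ‖L‖ ^ 2 ≤ (√(∑ i, L (EuclideanSpace.single i 1) ^ 2)) ^ 2 := by gcongr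
    _ = _ := Real.sq_sqrt h0

theorem contDiff_euclideanSpace_apply {N : ℕ} (i : Fin N) {n : WithTop ℕ∞} :
    ContDiff ℝ n (fun y : EuclideanSpace ℝ (Fin N) => y i) :=
  (EuclideanSpace.proj (𝕜 := ℝ) i : EuclideanSpace ℝ (Fin N) →L[ℝ] ℝ).contDiff

/-- The divergence theorem for the vector field `x ↦ g x • x`. -/
theorem integral_natCast_mul_add_fderiv_self {N : ℕ} {g : EuclideanSpace ℝ (Fin N) → ℝ}
    (hg : ContDiff ℝ 1 g) (hgs : HasCompactSupport g) :
    ∫ x, ((N : ℝ) * g x + fderiv ℝ g x x) = 0 := by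
  have hc : ∀ i : Fin N, ContDiff ℝ 1 (fun y : EuclideanSpace ℝ (Fin N) => y i * g y) := fun i =>
    (contDiff_euclideanSpace_apply i).mul hg
  have hs : ∀ i : Fin N, HasCompactSupport (fun y : EuclideanSpace ℝ (Fin N) => y i * g y) :=
    fun i => hgs.mul_left
  have hd : ∀ (i : Fin N) (x : EuclideanSpace ℝ (Fin N)),
      fderiv ℝ (fun y : EuclideanSpace ℝ (Fin N) => y i * g y) x (EuclideanSpace.single i 1)
        = g x + x i * fderiv ℝ g x (EuclideanSpace.single i 1) := by
    intro i x
    have h1 : HasFDerivAt (fun y : EuclideanSpace ℝ (Fin N) => y i)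
        (EuclideanSpace.proj (𝕜 := ℝ) i : EuclideanSpace ℝ (Fin N) →L[ℝ] ℝ) x :=
      (EuclideanSpace.proj (𝕜 := ℝ) i : EuclideanSpace ℝ (Fin N) →L[ℝ] ℝ).hasFDerivAt
    have h2 := h1.mul (hg.differentiable one_ne_zero x).hasFDerivAt
    have h3 : fderiv ℝ (fun y : EuclideanSpace ℝ (Fin N) => y i * g y) x = _ := h2.fderiv
    rw [h3]
    simp
    ring
  have key : ∀ x : EuclideanSpace ℝ (Fin N), (N : ℝ) * g x + fderiv ℝ g x x =
      ∑ i, fderiv ℝ (fun y : EuclideanSpace ℝ (Fin N) => y i * g y) x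
        (EuclideanSpace.single i 1) := by
    intro x
    rw [Finset.sum_congr rfl (fun i _ => hd i x), Finset.sum_add_distrib,
      ← EuclideanSpace.clm_apply_eq_sum]
    simp
  simp_rw [key]
  rw [integral_finsetSum]
  · exact Finset.sum_eq_zero fun i _ => integral_fderiv_apply_eq_zero volume (hc i) (hs i) _
  · intro i _
    exact (((hc i).continuous_fderiv one_ne_zero).clm_apply
      continuous_const).integrable_of_hasCompactSupport ((hs i).fderiv_apply (𝕜 := ℝ) _)

section Weight

variable {E : Type*} [NormedAddCommGroup E] [InnerProductSpace ℝ E]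

theorem hasFDerivAt_norm_sq_add_rpow {ε : ℝ} (hε : 0 < ε) (s : ℝ) (x : E) :
    HasFDerivAt (fun y : E => (‖y‖ ^ 2 + ε) ^ s)
      ((s * (‖x‖ ^ 2 + ε) ^ (s - 1)) • ((2 : ℝ) • innerSL ℝ x)) x := by
  have h1 : HasFDerivAt (fun y : E => ‖y‖ ^ 2 + ε) ((2 : ℝ) • innerSL ℝ x) x := by
    have h := (hasStrictFDerivAt_norm_sq x).hasFDerivAt.add_const ε
    have h2 : ((2 : ℝ) • innerSL ℝ x) = (2 : ℕ) • innerSL ℝ x := by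
      ext v
      simp [two_mul]
    rw [h2]
    exact h
  exact h1.rpow_const (Or.inl (by positivity))

theorem contDiff_norm_sq_add_rpow {ε : ℝ} (hε : 0 < ε) (s : ℝ) {n : WithTop ℕ∞} :
    ContDiff ℝ n (fun y : E => (‖y‖ ^ 2 + ε) ^ s) :=
  ((contDiff_norm_sq ℝ).add contDiff_const).rpow_const_of_ne fun x => by positivity

end Weight

theorem hardy_pointwise {n α W r a b c : ℝ} (hn : 5 ≤ n) (hα1 : 0 < α) (hα2 : α < 2)
    (hW : 0 < W) (hrW : r ^ 2 ≤ W) (hc : |c| ≤ b * r) :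
    W ^ (α / 2 - 1) * a ^ 2 - W ^ (α / 2) * b ^ 2 ≤
      n * (W ^ (α / 2 - 1) * a ^ 2) + (2 * (α / 2 - 1) * (r ^ 2 * W ^ (α / 2 - 1 - 1)) * a ^ 2 +
          2 * W ^ (α / 2 - 1) * (a * c)) := by
  have h1 : r ^ 2 * W ^ (α / 2 - 1 - 1) ≤ W ^ (α / 2 - 1) := by
    calc r ^ 2 * W ^ (α / 2 - 1 - 1) ≤ W * W ^ (α / 2 - 1 - 1) := by gcongr
      _ = W ^ (α / 2 - 1) := by
          rw [← Real.rpow_one_add' hW.le (by linarith)]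
          ring_nf
  have hW2 : W ^ (α / 2) = W ^ (α / 2 - 1) * W := by
    rw [← Real.rpow_add_one hW.ne']; ring_nf
  rw [hW2]
  set B := W ^ (α / 2 - 1) with hB
  have hB0 : 0 < B := by positivity
  have h2 : -(a ^ 2 + W * b ^ 2) ≤ 2 * (a * c) := by
    have h3 : |a * c| ≤ |a| * (b * r) := by rw [abs_mul]; gcongr
    have h4 := neg_le_of_abs_le h3
    have h5 : r ^ 2 * b ^ 2 ≤ W * b ^ 2 := by gcongr
    nlinarith [sq_nonneg (|a| - b * r), sq_abs a]
  have h3 : B * -(a ^ 2 + W * b ^ 2) ≤ B * (2 * (a * c)) := by gcongr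
  have h6 : r ^ 2 * W ^ (α / 2 - 1 - 1) * a ^ 2 ≤ B * a ^ 2 := by gcongr
  have h7 : 0 ≤ r ^ 2 * W ^ (α / 2 - 1 - 1) * a ^ 2 := by positivity
  have h8 : (5 : ℝ) * (B * a ^ 2) ≤ n * (B * a ^ 2) := by gcongr
  have h9 : 0 ≤ B * a ^ 2 := by positivity
  nlinarith

/-- A regularised weighted Hardy inequality. -/
theorem hardy_norm_sq_add {N : ℕ} (hN : 5 ≤ N) {α ε : ℝ} (hα1 : 0 < α) (hα2 : α < 2) (hε : 0 < ε)
    {v : EuclideanSpace ℝ (Fin N) → ℝ} (hv : ContDiff ℝ 1 v) (hvs : HasCompactSupport v) :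
    ∫ x, (‖x‖ ^ 2 + ε) ^ (α / 2 - 1) * v x ^ 2 ≤
      ∫ x, (‖x‖ ^ 2 + ε) ^ (α / 2) * ‖fderiv ℝ v x‖ ^ 2 := by
  let g : EuclideanSpace ℝ (Fin N) → ℝ := fun x => (‖x‖ ^ 2 + ε) ^ (α / 2 - 1) * v x ^ 2
  have hg : ContDiff ℝ 1 g := (contDiff_norm_sq_add_rpow hε _).mul (hv.pow 2)
  have hgs : HasCompactSupport g := hvs.mono fun x hx hx' => hx (by simp [g, hx'])
  have hgi : Integrable g := hg.continuous.integrable_of_hasCompactSupport hgs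
  have hdi : Integrable (fun x => fderiv ℝ g x x) :=
    ((hg.continuous_fderiv one_ne_zero).clm_apply continuous_id).integrable_of_hasCompactSupport
      ((hgs.fderiv (𝕜 := ℝ)).mono fun x hx hx' => hx (by simp [hx']))
  have hri : Integrable (fun x => (‖x‖ ^ 2 + ε) ^ (α / 2) * ‖fderiv ℝ v x‖ ^ 2) :=
    (((contDiff_norm_sq_add_rpow hε _ (n := 1)).continuous).mul
      ((hv.continuous_fderiv one_ne_zero).norm.pow 2)).integrable_of_hasCompactSupport
      ((hvs.fderiv (𝕜 := ℝ)).mono fun x hx hx' => hx (by simp [hx']))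
  have hpt : ∀ x, g x - (‖x‖ ^ 2 + ε) ^ (α / 2) * ‖fderiv ℝ v x‖ ^ 2 ≤
      (N : ℝ) * g x + fderiv ℝ g x x := by
    intro x
    have hd : fderiv ℝ g x x =
        2 * (α / 2 - 1) * (‖x‖ ^ 2 * (‖x‖ ^ 2 + ε) ^ (α / 2 - 1 - 1)) * v x ^ 2 +
          2 * (‖x‖ ^ 2 + ε) ^ (α / 2 - 1) * (v x * fderiv ℝ v x x) := by
      have h1 := (hasFDerivAt_norm_sq_add_rpow hε (α / 2 - 1) x).mul
        ((hv.differentiable one_ne_zero x).hasFDerivAt.pow 2)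
      have h3 : fderiv ℝ g x = _ := h1.fderiv
      rw [h3]
      simp
      ring
    rw [hd]
    exact hardy_pointwise (by exact_mod_cast hN) hα1 hα2 (by positivity) (by linarith)
      ((fderiv ℝ v x).le_opNorm x)
  have h := integral_mono (hgi.sub hri) ((hgi.const_mul (N : ℝ)).add hdi) hpt
  have h0 := integral_natCast_mul_add_fderiv_self hg hgs
  simp only [Pi.add_apply, Pi.sub_apply] at h
  rw [h0, integral_sub hgi hri] at h
  exact sub_nonpos.mp h

/-- The Sobolev inequality of `H¹`, in terms of Bochner integrals. -/
theorem exists_sobolev_sq {N : ℕ} (hN : 5 ≤ N) :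
    ∃ C : ℝ, 0 < C ∧ ∀ v : EuclideanSpace ℝ (Fin N) → ℝ, ContDiff ℝ 1 v → HasCompactSupport v →
      (∫ x, |v x| ^ (2 * (N : ℝ) / (N - 2))) ^ (((N : ℝ) - 2) / N) ≤
        C * ∫ x, ‖fderiv ℝ v x‖ ^ 2 := by
  have hN' : (5 : ℝ) ≤ N := by exact_mod_cast hN
  set K : NNReal := SNormLESNormFDerivOfEqConst ℝ
    (volume : Measure (EuclideanSpace ℝ (Fin N))) ((2 : NNReal) : ℝ) with hK
  refine ⟨(K : ℝ) ^ 2 + 1, by positivity, fun v hv hvs => ?_⟩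
  have hq : 0 < 2 * (N : ℝ) / (N - 2) := by apply div_pos <;> linarith
  set p' : NNReal := ⟨2 * (N : ℝ) / (N - 2), hq.le⟩ with hp'
  have hp'0 : (p' : ℝ) = 2 * (N : ℝ) / (N - 2) := rfl
  have hp'ne : (p' : ENNReal) ≠ 0 := by
    rw [ENNReal.coe_ne_zero, ← NNReal.coe_ne_zero, hp'0]; exact hq.ne'
  have h := eLpNorm_le_eLpNorm_fderiv_of_eq (F := ℝ)
    (volume : Measure (EuclideanSpace ℝ (Fin N))) hv hvs (p := 2) (p' := p') (by norm_num)
    (by simp; omega) (by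
      rw [hp'0]; simp
      have : (N : ℝ) ≠ 0 := by linarith
      have : (N : ℝ) - 2 ≠ 0 := by linarith
      field_simp)
  have hm1 : MemLp v p' volume := hv.continuous.memLp_of_hasCompactSupport hvs
  have hm2 : MemLp (fderiv ℝ v) ((2 : NNReal) : ENNReal) volume :=
    (hv.continuous_fderiv one_ne_zero).memLp_of_hasCompactSupport (hvs.fderiv (𝕜 := ℝ))
  rw [hm1.eLpNorm_eq_integral_rpow_norm hp'ne ENNReal.coe_ne_top,
    hm2.eLpNorm_eq_integral_rpow_norm (by simp) ENNReal.coe_ne_top, ← hK,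
    ← ENNReal.ofReal_coe_nnreal (p := K), ← ENNReal.ofReal_mul K.coe_nonneg,
    ENNReal.ofReal_le_ofReal_iff (by positivity)] at h
  simp only [ENNReal.coe_toReal, hp'0, Real.norm_eq_abs] at h
  have hI0 : 0 ≤ ∫ x, |v x| ^ (2 * (N : ℝ) / (N - 2)) := integral_nonneg fun _ => by positivity
  have hJ0 : 0 ≤ ∫ x, ‖fderiv ℝ v x‖ ^ 2 := integral_nonneg fun _ => by positivity
  have h2 := pow_le_pow_left₀ (by positivity) h 2
  have e1 : ((∫ x, |v x| ^ (2 * (N : ℝ) / (N - 2))) ^ (2 * (N : ℝ) / (N - 2))⁻¹) ^ 2 =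
      (∫ x, |v x| ^ (2 * (N : ℝ) / (N - 2))) ^ (((N : ℝ) - 2) / N) := by
    rw [← Real.rpow_natCast, ← Real.rpow_mul hI0]
    congr 1
    have : (N : ℝ) ≠ 0 := by linarith
    have : (N : ℝ) - 2 ≠ 0 := by linarith
    push_cast
    field_simp
  rw [e1] at h2
  refine h2.trans ?_
  have e2 : ((∫ x, ‖fderiv ℝ v x‖ ^ ((2 : NNReal) : ℝ)) ^ (((2 : NNReal) : ℝ)⁻¹)) ^ 2 =
      ∫ x, ‖fderiv ℝ v x‖ ^ 2 := by
    have : ∀ x, ‖fderiv ℝ v x‖ ^ ((2 : NNReal) : ℝ) = ‖fderiv ℝ v x‖ ^ 2 := by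
      intro x
      simp
    simp_rw [this]
    rw [← Real.rpow_natCast, ← Real.rpow_mul hJ0]
    simp
  rw [mul_pow, e2]
  nlinarith

theorem integral_rpow_mul_rpow_le {E : Type*} [NormedAddCommGroup E] [MeasurableSpace E]
    [BorelSpace E] {μ : Measure E} [IsFiniteMeasureOnCompacts μ] {f g : E → ℝ}
    (hf : Continuous f) (hg : Continuous g) (hfs : HasCompactSupport f)
    (hgs : HasCompactSupport g) (hf0 : ∀ x, 0 ≤ f x) (hg0 : ∀ x, 0 ≤ g x) {a b : ℝ} (ha : 0 < a)
    (hb : 0 < b) (hab : a + b = 1) :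
    ∫ x, f x ^ a * g x ^ b ∂μ ≤ (∫ x, f x ∂μ) ^ a * (∫ x, g x ∂μ) ^ b := by
  have hpq : (1 / a).HolderConjugate (1 / b) := by
    refine ⟨by simpa using hab, by positivity, by positivity⟩
  have hmf : MemLp (fun x => f x ^ a) (ENNReal.ofReal (1 / a)) μ :=
    (hf.rpow_const fun _ => Or.inr ha.le).memLp_of_hasCompactSupport
      (hfs.mono fun x hx hx' => hx (by simp [hx', ha.ne']))
  have hmg : MemLp (fun x => g x ^ b) (ENNReal.ofReal (1 / b)) μ :=
    (hg.rpow_const fun _ => Or.inr hb.le).memLp_of_hasCompactSupport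
      (hgs.mono fun x hx hx' => hx (by simp [hx', hb.ne']))
  have h := integral_mul_le_Lp_mul_Lq_of_nonneg hpq
    (Eventually.of_forall fun x => Real.rpow_nonneg (hf0 x) a)
    (Eventually.of_forall fun x => Real.rpow_nonneg (hg0 x) b) hmf hmg
  have e1 : ∀ x, (f x ^ a) ^ (1 / a) = f x := fun x => by
    rw [one_div, Real.rpow_rpow_inv (hf0 x) ha.ne']
  have e2 : ∀ x, (g x ^ b) ^ (1 / b) = g x := fun x => by
    rw [one_div, Real.rpow_rpow_inv (hg0 x) hb.ne']
  simpa only [e1, e2, one_div_one_div] using h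

theorem sq_norm_fderiv_weight_mul_le {E : Type*} [NormedAddCommGroup E] [InnerProductSpace ℝ E]
    {α ε : ℝ} (hα1 : 0 < α) (hα2 : α < 2) (hε : 0 < ε) {v : E → ℝ} (hv : Differentiable ℝ v)
    (x : E) :
    ‖fderiv ℝ (fun y => (‖y‖ ^ 2 + ε) ^ (α / 4) * v y) x‖ ^ 2 ≤
      2 * ((‖x‖ ^ 2 + ε) ^ (α / 2) * ‖fderiv ℝ v x‖ ^ 2) +
        2 * ((‖x‖ ^ 2 + ε) ^ (α / 2 - 1) * v x ^ 2) := by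
  have h1 := (hasFDerivAt_norm_sq_add_rpow hε (α / 4) x).mul (hv x).hasFDerivAt
  have h3 : fderiv ℝ (fun y => (‖y‖ ^ 2 + ε) ^ (α / 4) * v y) x = _ := h1.fderiv
  rw [h3]
  set W := ‖x‖ ^ 2 + ε with hW
  have hWpos : 0 < W := by positivity
  have hx : ‖x‖ ^ 2 ≤ W := by linarith
  have e1 : (W ^ (α / 4)) ^ 2 = W ^ (α / 2) := by
    rw [← Real.rpow_natCast, ← Real.rpow_mul hWpos.le]; congr 1; push_cast; ring
  have e2 : W * (W ^ (α / 4 - 1)) ^ 2 = W ^ (α / 2 - 1) := by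
    rw [← Real.rpow_natCast, ← Real.rpow_mul hWpos.le, ← Real.rpow_one_add' hWpos.le]
    · congr 1; push_cast; ring
    · push_cast; linarith
  have hn1 : ‖W ^ (α / 4) • fderiv ℝ v x‖ = W ^ (α / 4) * ‖fderiv ℝ v x‖ := by
    rw [norm_smul, Real.norm_of_nonneg (by positivity)]
  have hn2 : ‖v x • ((α / 4 * W ^ (α / 4 - 1)) • ((2 : ℝ) • innerSL ℝ x))‖ =
      |v x| * (α / 2 * W ^ (α / 4 - 1) * ‖x‖) := by
    rw [norm_smul, norm_smul, norm_smul, Real.norm_of_nonneg (r := α / 4 * _) (by positivity),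
      innerSL_apply_norm, Real.norm_eq_abs, Real.norm_two]
    ring
  have hn := norm_add_le (W ^ (α / 4) • fderiv ℝ v x)
    (v x • ((α / 4 * W ^ (α / 4 - 1)) • ((2 : ℝ) • innerSL ℝ x)))
  rw [hn1, hn2] at hn
  have h4 : (|v x| * (α / 2 * W ^ (α / 4 - 1) * ‖x‖)) ^ 2 ≤ W ^ (α / 2 - 1) * v x ^ 2 := by
    calc (|v x| * (α / 2 * W ^ (α / 4 - 1) * ‖x‖)) ^ 2
        = (α / 2) ^ 2 * (‖x‖ ^ 2 * (W ^ (α / 4 - 1)) ^ 2 * v x ^ 2) := by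
          rw [← sq_abs (v x)]; ring
      _ ≤ 1 * (W * (W ^ (α / 4 - 1)) ^ 2 * v x ^ 2) := by
          gcongr
          nlinarith
      _ = _ := by rw [one_mul, e2]
  have h5 : (W ^ (α / 4) * ‖fderiv ℝ v x‖) ^ 2 = W ^ (α / 2) * ‖fderiv ℝ v x‖ ^ 2 := by
    rw [mul_pow, e1]
  have h6 := pow_le_pow_left₀ (norm_nonneg _) hn 2
  have h7 := add_sq_le (a := W ^ (α / 4) * ‖fderiv ℝ v x‖)
    (b := |v x| * (α / 2 * W ^ (α / 4 - 1) * ‖x‖))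
  linarith

theorem abs_rpow_eq_interpolation {n α W t : ℝ} (hn : 5 ≤ n) (hα1 : 0 < α) (hW : 0 < W) :
    |t| ^ (2 * n / (n - 2 + α)) =
      (|W ^ (α / 4) * t| ^ (2 * n / (n - 2))) ^ ((1 - α / 2) * (n - 2) / (n - 2 + α)) *
        (W ^ (α / 2 - 1) * t ^ 2) ^ (α / 2 * n / (n - 2 + α)) := by
  have hd1 : 0 < n - 2 := by linarith
  have hd2 : 0 < n - 2 + α := by linarith
  rcases eq_or_ne t 0 with rfl | ht
  · have : 2 * n / (n - 2 + α) ≠ 0 := by positivity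
    have h2 : α / 2 * n / (n - 2 + α) ≠ 0 := by positivity
    simp [Real.zero_rpow this, Real.zero_rpow h2]
  have ht' : 0 < |t| := abs_pos.mpr ht
  rw [abs_mul, abs_of_pos (Real.rpow_pos_of_pos hW _), ← sq_abs t, ← Real.rpow_natCast |t| 2,
    Real.mul_rpow (by positivity) (by positivity), Real.mul_rpow (by positivity) (by positivity),
    Real.mul_rpow (by positivity) (by positivity)]
  simp only [← Real.rpow_mul hW.le, ← Real.rpow_mul ht'.le]
  rw [mul_mul_mul_comm, ← Real.rpow_add hW, ← Real.rpow_add ht']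
  have e1 : α / 4 * (2 * n / (n - 2)) * ((1 - α / 2) * (n - 2) / (n - 2 + α)) +
      (α / 2 - 1) * (α / 2 * n / (n - 2 + α)) = 0 := by
    field_simp; ring
  have e2 : 2 * n / (n - 2) * ((1 - α / 2) * (n - 2) / (n - 2 + α)) +
      ((2 : ℕ) : ℝ) * (α / 2 * n / (n - 2 + α)) = 2 * n / (n - 2 + α) := by
    push_cast; field_simp; ring
  rw [e1, e2, Real.rpow_zero, one_mul]

/-- A regularised first-order Caffarelli–Kohn–Nirenberg inequality, with constant independent of
the regularisation parameter. -/
theorem exists_ckn_norm_sq_add {N : ℕ} (hN : 5 ≤ N) {α : ℝ} (hα1 : 0 < α) (hα2 : α < 2) :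
    ∃ C : ℝ, 0 < C ∧ ∀ ε : ℝ, 0 < ε → ∀ v : EuclideanSpace ℝ (Fin N) → ℝ, ContDiff ℝ 1 v →
      HasCompactSupport v →
      (∫ x, |v x| ^ (2 * (N : ℝ) / (N - 2 + α))) ^ (((N : ℝ) - 2 + α) / N) ≤
        C * ∫ x, (‖x‖ ^ 2 + ε) ^ (α / 2) * ‖fderiv ℝ v x‖ ^ 2 := by
  obtain ⟨C, hC, hS⟩ := exists_sobolev_sq hN
  have hN' : (5 : ℝ) ≤ N := by exact_mod_cast hN
  have hd1 : 0 < (N : ℝ) - 2 := by linarith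
  have hd2 : 0 < (N : ℝ) - 2 + α := by linarith
  have hd3 : 0 < (N : ℝ) := by linarith
  refine ⟨(4 * C) ^ (1 - α / 2), by positivity, fun ε hε v hv hvs => ?_⟩
  let V : EuclideanSpace ℝ (Fin N) → ℝ := fun y => (‖y‖ ^ 2 + ε) ^ (α / 4) * v y
  let h : EuclideanSpace ℝ (Fin N) → ℝ := fun x => (‖x‖ ^ 2 + ε) ^ (α / 2 - 1) * v x ^ 2
  let e : EuclideanSpace ℝ (Fin N) → ℝ := fun x => (‖x‖ ^ 2 + ε) ^ (α / 2) * ‖fderiv ℝ v x‖ ^ 2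
  have hV : ContDiff ℝ 1 V := (contDiff_norm_sq_add_rpow hε _).mul hv
  have hVs : HasCompactSupport V := hvs.mono fun x hx hx' => hx (by simp [V, hx'])
  have hhc : Continuous h :=
    ((contDiff_norm_sq_add_rpow hε _ (n := 1)).continuous).mul (hv.continuous.pow 2)
  have hhs : HasCompactSupport h := hvs.mono fun x hx hx' => hx (by simp [h, hx'])
  have hec : Continuous e := ((contDiff_norm_sq_add_rpow hε _ (n := 1)).continuous).mul
    ((hv.continuous_fderiv one_ne_zero).norm.pow 2)
  have hes : HasCompactSupport e :=
    (hvs.fderiv (𝕜 := ℝ)).mono fun x hx hx' => hx (by simp [e, hx'])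
  have hhi : Integrable h := hhc.integrable_of_hasCompactSupport hhs
  have hei : Integrable e := hec.integrable_of_hasCompactSupport hes
  have hh0 : ∀ x, 0 ≤ h x := fun x => by positivity
  have hHE : ∫ x, h x ≤ ∫ x, e x := hardy_norm_sq_add hN hα1 hα2 hε hv hvs
  have hH0 : 0 ≤ ∫ x, h x := integral_nonneg hh0
  have hE0 : 0 ≤ ∫ x, e x := hH0.trans hHE
  have hDV : ∫ x, ‖fderiv ℝ V x‖ ^ 2 ≤ 4 * ∫ x, e x := by
    have hi : Integrable (fun x => ‖fderiv ℝ V x‖ ^ 2) :=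
      ((hV.continuous_fderiv one_ne_zero).norm.pow 2).integrable_of_hasCompactSupport
        ((hVs.fderiv (𝕜 := ℝ)).mono fun x hx hx' => hx (by simp [hx']))
    have h1 := integral_mono hi ((hei.const_mul 2).add (hhi.const_mul 2)) fun x =>
      sq_norm_fderiv_weight_mul_le hα1 hα2 hε (hv.differentiable one_ne_zero) x
    simp only [Pi.add_apply] at h1
    rw [integral_add (hei.const_mul 2) (hhi.const_mul 2), integral_const_mul,
      integral_const_mul] at h1
    linarith
  let T : EuclideanSpace ℝ (Fin N) → ℝ := fun x => |V x| ^ (2 * (N : ℝ) / (N - 2))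
  have hTq : 0 < 2 * (N : ℝ) / (N - 2) := by positivity
  have hTc : Continuous T := hV.continuous.abs.rpow_const fun _ => Or.inr hTq.le
  have hTs : HasCompactSupport T :=
    hVs.mono fun x hx hx' => hx (by simp [T, hx', hTq.ne'])
  have hT0 : ∀ x, 0 ≤ T x := fun x => by positivity
  have hIT0 : 0 ≤ ∫ x, T x := integral_nonneg hT0
  have hT : (∫ x, T x) ^ (((N : ℝ) - 2) / N) ≤ 4 * C * ∫ x, e x := by
    calc _ ≤ C * ∫ x, ‖fderiv ℝ V x‖ ^ 2 := hS V hV hVs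
      _ ≤ C * (4 * ∫ x, e x) := by gcongr
      _ = _ := by ring
  have hα3 : 0 < 1 - α / 2 := by linarith
  have hI : ∫ x, |v x| ^ (2 * (N : ℝ) / (N - 2 + α)) ≤
      (∫ x, T x) ^ ((1 - α / 2) * ((N : ℝ) - 2) / (N - 2 + α)) *
        (∫ x, h x) ^ (α / 2 * N / (N - 2 + α)) := by
    have h1 := integral_rpow_mul_rpow_le (μ := volume) hTc hhc hTs hhs hT0 hh0
      (a := (1 - α / 2) * ((N : ℝ) - 2) / (N - 2 + α)) (b := α / 2 * N / (N - 2 + α))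
      (by positivity) (by positivity) (by field_simp; ring)
    refine le_trans (le_of_eq (integral_congr_ae (Eventually.of_forall fun x => ?_))) h1
    exact abs_rpow_eq_interpolation hN' hα1 (by positivity)
  calc (∫ x, |v x| ^ (2 * (N : ℝ) / (N - 2 + α))) ^ (((N : ℝ) - 2 + α) / N)
      ≤ ((∫ x, T x) ^ ((1 - α / 2) * ((N : ℝ) - 2) / (N - 2 + α)) *
        (∫ x, h x) ^ (α / 2 * N / (N - 2 + α))) ^ (((N : ℝ) - 2 + α) / N) := by
        gcongr
    _ = ((∫ x, T x) ^ (((N : ℝ) - 2) / N)) ^ (1 - α / 2) * (∫ x, h x) ^ (α / 2) := by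
        rw [Real.mul_rpow (by positivity) (by positivity), ← Real.rpow_mul hIT0,
          ← Real.rpow_mul hIT0, ← Real.rpow_mul hH0]
        congr 2 <;> field_simp
    _ ≤ (4 * C * ∫ x, e x) ^ (1 - α / 2) * (∫ x, e x) ^ (α / 2) := by gcongr
    _ = (4 * C) ^ (1 - α / 2) * ∫ x, e x := by
        rw [Real.mul_rpow (by positivity) hE0, mul_assoc, ← Real.rpow_add_of_nonneg hE0 hα3.le
          (by positivity)]
        simp

theorem hasDerivAt_abs_rpow_mul_self {s : ℝ} (hs : 0 < s) (t : ℝ) :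
    HasDerivAt (fun t : ℝ => |t| ^ s * t) ((s + 1) * |t| ^ s) t := by
  have hc : Continuous fun t : ℝ => |t| ^ s := continuous_abs.rpow_const fun _ => Or.inr hs.le
  have hne : ∀ t : ℝ, t ≠ 0 → HasDerivAt (fun t : ℝ => |t| ^ s * t) ((s + 1) * |t| ^ s) t := by
    intro t ht
    have h1 := ((hasDerivAt_abs ht).rpow_const (p := s) (Or.inl (abs_ne_zero.mpr ht))).mul
      (hasDerivAt_id t)
    refine h1.congr_deriv ?_
    have h2 : |t| ^ s = |t| ^ (s - 1) * |t| := by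
      rw [← Real.rpow_add_one (abs_ne_zero.mpr ht)]; ring_nf
    have h3 : (SignType.sign t : ℝ) * t = |t| := sign_mul_self t
    simp only [id]
    rw [h2, ← h3]
    ring
  exact hasDerivAt_of_hasDerivAt_of_ne' hne (hc.mul continuous_id).continuousAt
    (continuous_const.mul hc).continuousAt t

theorem contDiff_abs_rpow_mul_self {s : ℝ} (hs : 0 < s) :
    ContDiff ℝ 1 (fun t : ℝ => |t| ^ s * t) := by
  rw [contDiff_one_iff_deriv]
  refine ⟨fun t => (hasDerivAt_abs_rpow_mul_self hs t).differentiableAt, ?_⟩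
  rw [funext fun t => (hasDerivAt_abs_rpow_mul_self hs t).deriv]
  exact continuous_const.mul (continuous_abs.rpow_const fun _ => Or.inr hs.le)

theorem integrable_norm_rpow_mul {N : ℕ} (hN : 0 < N) {s : ℝ} (hs : -(N : ℝ) < s)
    {h : EuclideanSpace ℝ (Fin N) → ℝ} (hh : Continuous h) (hhs : HasCompactSupport h) :
    Integrable (fun x => ‖x‖ ^ s * h x) := by
  have : Nonempty (Fin N) := ⟨⟨0, hN⟩⟩
  obtain ⟨R, hR0, hR⟩ := hhs.isCompact.isBounded.subset_ball_lt 0 0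
  obtain ⟨M, hM⟩ := hh.bounded_above_of_compact_support hhs
  have hball : IntegrableOn (fun x : EuclideanSpace ℝ (Fin N) => ‖x‖ ^ s) (Metric.ball 0 R) := by
    rw [integrableOn_fun_norm_addHaar volume (f := fun y => y ^ s)]
    have h1 : IntegrableOn (fun y : ℝ => y ^ (s + (N - 1 : ℕ))) (Set.Ioo 0 R) :=
      (intervalIntegral.integrableOn_Ioo_rpow_iff hR0).mpr (by
        have : ((N - 1 : ℕ) : ℝ) = N - 1 := by
          rw [Nat.cast_sub (by omega)]; simp
        rw [this]; linarith)
    refine h1.congr_fun (fun y hy => ?_) measurableSet_Ioo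
    have hy0 : 0 < y := hy.1
    simp only [finrank_euclideanSpace, Fintype.card_fin, smul_eq_mul]
    rw [Real.rpow_add hy0, Real.rpow_natCast, mul_comm]
  have h2 : IntegrableOn (fun x : EuclideanSpace ℝ (Fin N) => ‖x‖ ^ s * h x) (Metric.ball 0 R) :=
    Integrable.mul_bdd (c := M) hball hh.aestronglyMeasurable (Eventually.of_forall hM)
  rwa [integrableOn_iff_integrable_of_support_subset] at h2
  intro x hx
  refine hR (subset_tsupport _ fun h0 => hx ?_)
  simp [h0]

/-- The operator `div((|x|² + ε)^(α/2) ∇u)`, a smooth approximation of `wOp α`. -/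
def regOp {N : ℕ} (α ε : ℝ) (u : EuclideanSpace ℝ (Fin N) → ℝ) (x : EuclideanSpace ℝ (Fin N)) :
    ℝ :=
  (‖x‖ ^ 2 + ε) ^ (α / 2) * lap u x + α * (‖x‖ ^ 2 + ε) ^ (α / 2 - 1) * fderiv ℝ u x x

section SmoothCompact

variable {N : ℕ} {u : EuclideanSpace ℝ (Fin N) → ℝ}

theorem contDiff_fderiv_apply_single (hu : ContDiff ℝ (⊤ : ℕ∞) u) (i : Fin N) :
    ContDiff ℝ 1 (fun y => fderiv ℝ u y (EuclideanSpace.single i 1)) :=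
  (hu.fderiv_right (m := 1) (WithTop.coe_le_coe.mpr le_top)).clm_apply contDiff_const

theorem continuous_lap (hu : ContDiff ℝ (⊤ : ℕ∞) u) : Continuous (lap u) :=
  continuous_finsetSum _ fun i _ =>
    ((contDiff_fderiv_apply_single hu i).continuous_fderiv one_ne_zero).clm_apply continuous_const

theorem hasCompactSupport_lap (hus : HasCompactSupport u) : HasCompactSupport (lap u) := by
  refine HasCompactSupport.of_support_subset_isCompact hus.isCompact fun x hx => ?_
  by_contra hxs
  refine hx (Finset.sum_eq_zero fun i _ => ?_)
  have h1 : fderiv ℝ (fun y => fderiv ℝ u y (EuclideanSpace.single i (1 : ℝ))) x = 0 := by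
    by_contra h
    exact hxs (tsupport_fderiv_apply_subset ℝ _ (support_fderiv_subset ℝ h))
  rw [h1]; rfl

theorem continuous_fderiv_apply_self (hu : ContDiff ℝ (⊤ : ℕ∞) u) :
    Continuous (fun x => fderiv ℝ u x x) :=
  (hu.continuous_fderiv (by simp)).clm_apply continuous_id

/-- Testing the regularised equation against `|u|^s u`. -/
theorem integral_sq_grad_le_neg_integral_regOp {α ε s : ℝ} (hε : 0 < ε)
    (hs : 0 < s) (hu : ContDiff ℝ (⊤ : ℕ∞) u) (hus : HasCompactSupport u) :
    (s + 1) * ∫ x, (‖x‖ ^ 2 + ε) ^ (α / 2) * (|u x| ^ s * ‖fderiv ℝ u x‖ ^ 2) ≤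
      -∫ x, |u x| ^ s * u x * regOp α ε u x := by
  let Φ : EuclideanSpace ℝ (Fin N) → ℝ := fun x => (‖x‖ ^ 2 + ε) ^ (α / 2) * (|u x| ^ s * u x)
  have hu1 : ContDiff ℝ 1 u := hu.of_le (by exact_mod_cast le_top)
  have hΦ : ContDiff ℝ 1 Φ :=
    (contDiff_norm_sq_add_rpow hε _).mul ((contDiff_abs_rpow_mul_self hs).comp hu1)
  have hdΦ : ∀ x v, fderiv ℝ Φ x v = (‖x‖ ^ 2 + ε) ^ (α / 2) * ((s + 1) * |u x| ^ s) *
      fderiv ℝ u x v + α * (‖x‖ ^ 2 + ε) ^ (α / 2 - 1) * (|u x| ^ s * u x) * inner ℝ x v := by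
    intro x v
    have h1 : HasFDerivAt (fun y => |u y| ^ s * u y) (((s + 1) * |u x| ^ s) • fderiv ℝ u x) x :=
      (hasDerivAt_abs_rpow_mul_self hs (u x)).comp_hasFDerivAt x
        (hu1.differentiable one_ne_zero x).hasFDerivAt
    have h2 := (hasFDerivAt_norm_sq_add_rpow hε (α / 2) x).mul h1
    have h3 : fderiv ℝ Φ x = _ := h2.fderiv
    rw [h3]
    simp
    ring
  let F : Fin N → EuclideanSpace ℝ (Fin N) → ℝ := fun i x =>
    Φ x * fderiv ℝ u x (EuclideanSpace.single i 1)
  have hF : ∀ i, ContDiff ℝ 1 (F i) := fun i => hΦ.mul (contDiff_fderiv_apply_single hu i)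
  have hFs : ∀ i, HasCompactSupport (F i) := fun i =>
    hus.mono fun x hx hx' => hx (by simp [F, Φ, hx'])
  have hdF : ∀ i x, fderiv ℝ (F i) x (EuclideanSpace.single i 1) =
      Φ x * fderiv ℝ (fun y => fderiv ℝ u y (EuclideanSpace.single i 1)) x
        (EuclideanSpace.single i 1) +
      ((‖x‖ ^ 2 + ε) ^ (α / 2) * ((s + 1) * |u x| ^ s) *
        fderiv ℝ u x (EuclideanSpace.single i 1) ^ 2 +
      α * (‖x‖ ^ 2 + ε) ^ (α / 2 - 1) * (|u x| ^ s * u x) *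
        (x i * fderiv ℝ u x (EuclideanSpace.single i 1))) := by
    intro i x
    have h1 := (hΦ.differentiable one_ne_zero x).hasFDerivAt.mul
      ((contDiff_fderiv_apply_single hu i).differentiable one_ne_zero x).hasFDerivAt
    have h3 : fderiv ℝ (F i) x = _ := h1.fderiv
    rw [h3]
    simp only [add_apply, smul_apply, smul_eq_mul, hdΦ]
    rw [EuclideanSpace.inner_single_right]
    simp
    ring
  have hsum : ∀ x, ∑ i, fderiv ℝ (F i) x (EuclideanSpace.single i 1) =
      |u x| ^ s * u x * regOp α ε u x + (s + 1) * ((‖x‖ ^ 2 + ε) ^ (α / 2) * (|u x| ^ s *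
        ∑ i, fderiv ℝ u x (EuclideanSpace.single i 1) ^ 2)) := by
    intro x
    simp only [hdF, Finset.sum_add_distrib, ← Finset.mul_sum]
    rw [← EuclideanSpace.clm_apply_eq_sum]
    simp only [regOp, lap, Φ]
    ring
  have hzero : ∫ x, ∑ i, fderiv ℝ (F i) x (EuclideanSpace.single i 1) = 0 := by
    rw [integral_finsetSum]
    · exact Finset.sum_eq_zero fun i _ => integral_fderiv_apply_eq_zero volume (hF i) (hFs i) _
    · intro i _
      exact (((hF i).continuous_fderiv one_ne_zero).clm_apply
        continuous_const).integrable_of_hasCompactSupport ((hFs i).fderiv_apply (𝕜 := ℝ) _)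
  have hwc : ∀ r : ℝ, Continuous fun x : EuclideanSpace ℝ (Fin N) => (‖x‖ ^ 2 + ε) ^ r := fun r =>
    (contDiff_norm_sq_add_rpow hε r (n := 1)).continuous
  have huc : Continuous fun x => |u x| ^ s := hu.continuous.abs.rpow_const fun _ => Or.inr hs.le
  have hi1 : Integrable (fun x => |u x| ^ s * u x * regOp α ε u x) :=
    ((huc.mul hu.continuous).mul (((hwc _).mul (continuous_lap hu)).add
      ((continuous_const.mul (hwc _)).mul
        (continuous_fderiv_apply_self hu)))).integrable_of_hasCompactSupport
      (hus.mono fun x hx hx' => hx (by simp [hx']))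
  have hi2 : Integrable (fun x => (‖x‖ ^ 2 + ε) ^ (α / 2) * (|u x| ^ s *
        ∑ i, fderiv ℝ u x (EuclideanSpace.single i 1) ^ 2)) :=
    ((hwc _).mul (huc.mul (continuous_finsetSum _ fun i _ =>
      (contDiff_fderiv_apply_single hu i).continuous.pow 2))).integrable_of_hasCompactSupport
      (hus.mono fun x hx hx' => hx (by simp [hx', hs.ne']))
  have hi3 : Integrable (fun x => (‖x‖ ^ 2 + ε) ^ (α / 2) * (|u x| ^ s * ‖fderiv ℝ u x‖ ^ 2)) :=
    ((hwc _).mul (huc.mul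
      ((hu1.continuous_fderiv one_ne_zero).norm.pow 2))).integrable_of_hasCompactSupport
      (hus.mono fun x hx hx' => hx (by simp [hx', hs.ne']))
  simp_rw [hsum] at hzero
  rw [integral_add hi1 (hi2.const_mul _), integral_const_mul] at hzero
  have hmono := integral_mono hi3 hi2 fun x => by
    have := EuclideanSpace.sq_norm_clm_le_sum (fderiv ℝ u x)
    dsimp only
    gcongr
  nlinarith

end SmoothCompact

section Limit

variable {N : ℕ} {u : EuclideanSpace ℝ (Fin N) → ℝ}

theorem memLp_norm_rpow_mul_fderiv_self {α : ℝ} (hN : 5 ≤ N) (hα : 0 < α)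
    (hu : ContDiff ℝ (⊤ : ℕ∞) u) (hus : HasCompactSupport u) :
    MemLp (fun x => ‖x‖ ^ (α - 2) * fderiv ℝ u x x) 2 volume := by
  have hN' : (5 : ℝ) ≤ N := by exact_mod_cast hN
  have hm : AEStronglyMeasurable (fun x => ‖x‖ ^ (α - 2) * fderiv ℝ u x x) volume :=
    ((measurable_norm.pow_const _).mul
      (continuous_fderiv_apply_self hu).measurable).aestronglyMeasurable
  rw [memLp_two_iff_integrable_sq hm]
  have hi : Integrable (fun x => ‖x‖ ^ (2 * α - 2) * ‖fderiv ℝ u x‖ ^ 2) :=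
    integrable_norm_rpow_mul (by omega) (by linarith)
      ((hu.continuous_fderiv (by simp)).norm.pow 2)
      ((hus.fderiv (𝕜 := ℝ)).mono fun x hx hx' => hx (by simp [hx']))
  refine hi.mono' (hm.pow 2) (Eventually.of_forall fun x => ?_)
  rw [Real.norm_of_nonneg (sq_nonneg _)]
  rcases eq_or_ne x 0 with rfl | hx
  · simp only [map_zero, mul_zero, zero_pow two_ne_zero]
    positivity
  have hr : 0 < ‖x‖ := norm_pos_iff.mpr hx
  calc (‖x‖ ^ (α - 2) * fderiv ℝ u x x) ^ 2
      = (‖x‖ ^ (α - 2)) ^ 2 * |fderiv ℝ u x x| ^ 2 := by rw [mul_pow, sq_abs]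
    _ ≤ (‖x‖ ^ (α - 2)) ^ 2 * (‖fderiv ℝ u x‖ * ‖x‖) ^ 2 := by
        gcongr
        exact (fderiv ℝ u x).le_opNorm x
    _ = (‖x‖ ^ (α - 2) * ‖x‖) ^ 2 * ‖fderiv ℝ u x‖ ^ 2 := by ring
    _ = ‖x‖ ^ (2 * α - 2) * ‖fderiv ℝ u x‖ ^ 2 := by
        rw [← Real.rpow_add_one hr.ne', ← Real.rpow_natCast, ← Real.rpow_mul hr.le]
        congr 2
        push_cast
        ring

/-- A common square-integrable majorant of `wOp α u` and of `regOp α ε u` for `ε ≤ 1`. -/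
def opMajorant (α : ℝ) (u : EuclideanSpace ℝ (Fin N) → ℝ) (x : EuclideanSpace ℝ (Fin N)) : ℝ :=
  (‖x‖ ^ 2 + 1) ^ (α / 2) * ‖lap u x‖ + α * ‖‖x‖ ^ (α - 2) * fderiv ℝ u x x‖

theorem memLp_opMajorant {α : ℝ} (hN : 5 ≤ N) (hα : 0 < α)
    (hu : ContDiff ℝ (⊤ : ℕ∞) u) (hus : HasCompactSupport u) :
    MemLp (opMajorant α u) 2 volume := by
  have h1 : MemLp (fun x => (‖x‖ ^ 2 + 1) ^ (α / 2) * ‖lap u x‖) 2 volume :=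
    (((contDiff_norm_sq_add_rpow one_pos _ (n := 1)).continuous).mul
      (continuous_lap hu).norm).memLp_of_hasCompactSupport
      ((hasCompactSupport_lap hus).mono fun x hx hx' => hx (by simp [hx']))
  exact h1.add ((memLp_norm_rpow_mul_fderiv_self hN hα hu hus).norm.const_mul α)

theorem norm_wOp_le {α : ℝ} (hα : 0 < α) (x : EuclideanSpace ℝ (Fin N)) :
    ‖wOp α u x‖ ≤ opMajorant α u x := by
  refine (norm_add_le _ _).trans (add_le_add ?_ ?_)
  · rw [norm_mul, Real.norm_of_nonneg (by positivity)]
    gcongr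
    calc ‖x‖ ^ α = (‖x‖ ^ 2) ^ (α / 2) := by
          rw [← Real.rpow_natCast, ← Real.rpow_mul (norm_nonneg x)]
          congr 1
          push_cast
          ring
      _ ≤ _ := by gcongr; linarith
  · rw [mul_assoc, norm_mul, Real.norm_of_nonneg hα.le]

theorem norm_sq_rpow_half_sub_one {α r : ℝ} (hr : 0 ≤ r) :
    (r ^ 2) ^ (α / 2 - 1) = r ^ (α - 2) := by
  rw [← Real.rpow_natCast, ← Real.rpow_mul hr]
  congr 1
  push_cast
  ring

theorem norm_regOp_le {α ε : ℝ} (hα1 : 0 < α) (hα2 : α < 2) (hε : 0 < ε) (hε1 : ε ≤ 1)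
    (x : EuclideanSpace ℝ (Fin N)) : ‖regOp α ε u x‖ ≤ opMajorant α u x := by
  refine (norm_add_le _ _).trans (add_le_add ?_ ?_)
  · rw [norm_mul, Real.norm_of_nonneg (by positivity)]
    gcongr
  · rw [mul_assoc, norm_mul, Real.norm_of_nonneg hα1.le, norm_mul, norm_mul]
    rcases eq_or_ne x 0 with rfl | hx
    · simp
    have hr : 0 < ‖x‖ := norm_pos_iff.mpr hx
    rw [Real.norm_of_nonneg (r := (‖x‖ ^ 2 + ε) ^ _) (by positivity),
      Real.norm_of_nonneg (r := ‖x‖ ^ _) (by positivity)]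
    gcongr
    rw [← norm_sq_rpow_half_sub_one hr.le]
    exact Real.rpow_le_rpow_of_nonpos (by positivity) (by linarith) (by linarith)

theorem tendsto_regOp {α : ℝ} (hα : 0 < α) {ε : ℕ → ℝ} (hε : Tendsto ε atTop (nhds 0))
    (x : EuclideanSpace ℝ (Fin N)) :
    Tendsto (fun n => regOp α (ε n) u x) atTop (nhds (wOp α u x)) := by
  have h0 : Tendsto (fun n => ‖x‖ ^ 2 + ε n) atTop (nhds (‖x‖ ^ 2)) := by
    simpa using hε.const_add (‖x‖ ^ 2)
  refine Tendsto.add ?_ ?_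
  · have h1 := (h0.rpow_const (p := α / 2) (Or.inr (by positivity))).mul_const (lap u x)
    have h2 : (‖x‖ ^ 2) ^ (α / 2) = ‖x‖ ^ α := by
      rw [← Real.rpow_natCast, ← Real.rpow_mul (norm_nonneg x)]
      congr 1
      push_cast
      ring
    rwa [h2] at h1
  · rcases eq_or_ne x 0 with rfl | hx
    · simp
    have h1 := ((h0.rpow_const (p := α / 2 - 1)
      (Or.inl (pow_ne_zero 2 (norm_ne_zero_iff.mpr hx)))).const_mul α).mul_const (fderiv ℝ u x x)
    rwa [norm_sq_rpow_half_sub_one (norm_nonneg x)] at h1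

theorem measurable_wOp {α : ℝ} (hu : ContDiff ℝ (⊤ : ℕ∞) u) : Measurable (wOp α u) :=
  ((measurable_norm.pow_const _).mul (continuous_lap hu).measurable).add
    ((measurable_const.mul (measurable_norm.pow_const _)).mul
      (continuous_fderiv_apply_self hu).measurable)

theorem continuous_regOp {α ε : ℝ} (hε : 0 < ε) (hu : ContDiff ℝ (⊤ : ℕ∞) u) :
    Continuous (regOp α ε u) := by
  have hwc : ∀ r : ℝ, Continuous fun x : EuclideanSpace ℝ (Fin N) => (‖x‖ ^ 2 + ε) ^ r := fun r =>
    (contDiff_norm_sq_add_rpow hε r (n := 1)).continuous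
  exact ((hwc _).mul (continuous_lap hu)).add
    ((continuous_const.mul (hwc _)).mul (continuous_fderiv_apply_self hu))

theorem tendsto_integral_mul_regOp {α : ℝ} (hN : 5 ≤ N) (hα1 : 0 < α) (hα2 : α < 2)
    (hu : ContDiff ℝ (⊤ : ℕ∞) u) (hus : HasCompactSupport u) {ψ : EuclideanSpace ℝ (Fin N) → ℝ}
    (hψ : Continuous ψ) (hψs : HasCompactSupport ψ) {ε : ℕ → ℝ} (hε0 : ∀ n, 0 < ε n)
    (hε1 : ∀ n, ε n ≤ 1) (hε : Tendsto ε atTop (nhds 0)) :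
    Tendsto (fun n => ∫ x, ψ x * regOp α (ε n) u x) atTop (nhds (∫ x, ψ x * wOp α u x)) := by
  have hψ2 : MemLp (fun x => ‖ψ x‖) 2 volume := (hψ.memLp_of_hasCompactSupport hψs).norm
  refine tendsto_integral_of_dominated_convergence (fun x => ‖ψ x‖ * opMajorant α u x)
    (fun n => (hψ.mul (continuous_regOp (hε0 n) hu)).aestronglyMeasurable)
    (hψ2.integrable_mul (memLp_opMajorant hN hα1 hu hus))
    (fun n => Eventually.of_forall fun x => ?_)
    (Eventually.of_forall fun x => (tendsto_regOp hα1 hε x).const_mul _)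
  rw [norm_mul]
  gcongr
  exact norm_regOp_le hα1 hα2 (hε0 n) (hε1 n) x

end Limit

theorem sq_norm_fderiv_abs_rpow {E : Type*} [NormedAddCommGroup E] [NormedSpace ℝ E] {u : E → ℝ}
    (hu : Differentiable ℝ u) {s : ℝ} (hs : 0 < s) (x : E) :
    ‖fderiv ℝ (fun y => |u y| ^ ((s + 2) / 2)) x‖ ^ 2 =
      ((s + 2) / 2) ^ 2 * (|u x| ^ s * ‖fderiv ℝ u x‖ ^ 2) := by
  have h1 : HasFDerivAt (fun y => |u y| ^ ((s + 2) / 2)) _ x :=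
    (hasDerivAt_abs_rpow (u x) (p := (s + 2) / 2) (by linarith)).comp_hasFDerivAt x
      (hu x).hasFDerivAt
  rw [h1.fderiv, norm_smul, mul_pow, Real.norm_eq_abs, sq_abs]
  have h2 : (|u x| ^ ((s + 2) / 2 - 2) * u x) ^ 2 = |u x| ^ s := by
    rcases eq_or_ne (u x) 0 with h0 | h0
    · simp [h0, Real.zero_rpow hs.ne']
    have hpos : 0 < |u x| := abs_pos.mpr h0
    rw [mul_pow, ← sq_abs (u x), ← mul_pow, ← Real.rpow_add_one hpos.ne', ← Real.rpow_natCast,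
      ← Real.rpow_mul hpos.le]
    congr 1
    push_cast
    ring
  rw [mul_assoc ((s + 2) / 2), mul_pow, h2]
  ring

theorem rpow_le_of_rpow_le_mul_sqrt {A F K θ : ℝ} (hA : 0 ≤ A) (hF : 0 ≤ F) (hθ : 0 < θ)
    (h : A ^ (θ / 2 + 1 / 2) ≤ K * (A ^ (1 / 2 : ℝ) * F ^ (1 / 2 : ℝ))) :
    A ^ θ ≤ K ^ 2 * F := by
  rcases hA.eq_or_lt with rfl | hA
  · rw [Real.zero_rpow hθ.ne']; positivity
  rw [Real.rpow_add hA] at h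
  have h1 : A ^ (θ / 2) ≤ K * F ^ (1 / 2 : ℝ) := by
    have : 0 < A ^ (1 / 2 : ℝ) := by positivity
    nlinarith
  have h2 := pow_le_pow_left₀ (by positivity) h1 2
  rw [mul_pow, ← Real.rpow_natCast, ← Real.rpow_mul hA.le, ← Real.rpow_natCast (F ^ _),
    ← Real.rpow_mul hF] at h2
  simpa using h2

/-- a new second-order Caffarelli–Kohn–Nirenberg inequality: there is `S > 0`
with `∫|div(|x|^α ∇u)|² ≥ S (∫|u|^{2**_α})^{2/2**_α}` for all `u ∈ C_c^∞(ℝ^N)`. -/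
theorem stmt17 (N : ℕ) (hN : 5 ≤ N) (α : ℝ) (hα1 : 0 < α) (hα2 : α < 2) :
    ∃ S : ℝ, 0 < S ∧ ∀ u : EuclideanSpace ℝ (Fin N) → ℝ,
      ContDiff ℝ (⊤ : ℕ∞) u → HasCompactSupport u →
      (∫ x, (wOp α u x)^2) ≥
        S * (∫ x, |u x| ^ (pexp N α)) ^ (((N : ℝ) - 4 + 2*α)/(N : ℝ)) := by
  have hN' : (5 : ℝ) ≤ N := by exact_mod_cast hN
  have hd0 : 0 < (N : ℝ) := by linarith
  have hd1 : 0 < (N : ℝ) - 4 + 2 * α := by linarith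
  have hd2 : 0 < (N : ℝ) - 2 + α := by linarith
  obtain ⟨C, hC, hckn⟩ := exists_ckn_norm_sq_add hN hα1 hα2
  set s : ℝ := (4 - 2 * α) / ((N : ℝ) - 4 + 2 * α) with hs
  have hs0 : 0 < s := div_pos (by linarith) hd1
  set K : ℝ := C * ((s + 2) / 2) ^ 2 / (s + 1) with hK
  have hK0 : 0 < K := by positivity
  refine ⟨(K ^ 2)⁻¹, by positivity, fun u hu hus => ?_⟩
  have hu1 : ContDiff ℝ 1 u := hu.of_le (by exact_mod_cast le_top)
  have hp0 : 0 < pexp N α := div_pos (by linarith) hd1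
  let v : EuclideanSpace ℝ (Fin N) → ℝ := fun x => |u x| ^ ((s + 2) / 2)
  let ψ : EuclideanSpace ℝ (Fin N) → ℝ := fun x => |u x| ^ s * u x
  have hv : ContDiff ℝ 1 v :=
    (contDiff_norm_rpow (E := ℝ) (p := (s + 2) / 2) (by linarith)).comp hu1
  have hvs : HasCompactSupport v := hus.mono fun x hx hx' => hx (by
    have : (s + 2) / 2 ≠ 0 := by positivity
    simp [v, hx', Real.zero_rpow this])
  have hψ : Continuous ψ := ((contDiff_abs_rpow_mul_self hs0).comp hu1).continuous
  have hψs : HasCompactSupport ψ := hus.mono fun x hx hx' => hx (by simp [ψ, hx'])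
  have hvp : ∀ x, |v x| ^ (2 * (N : ℝ) / (N - 2 + α)) = |u x| ^ pexp N α := by
    intro x
    simp only [v]
    rw [abs_of_nonneg (by positivity), ← Real.rpow_mul (abs_nonneg _)]
    congr 1
    rw [hs, pexp]
    field_simp
    ring
  have hψp : ∀ x, ‖ψ x‖ ^ (2 : ℝ) = |u x| ^ pexp N α := by
    intro x
    simp only [ψ]
    rcases eq_or_ne (u x) 0 with h0 | h0
    · simp [h0, Real.zero_rpow hp0.ne']
    have hpos : 0 < |u x| := abs_pos.mpr h0
    rw [norm_mul, Real.norm_of_nonneg (by positivity), Real.norm_eq_abs,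
      ← Real.rpow_add_one hpos.ne', ← Real.rpow_mul hpos.le]
    congr 1
    rw [hs, pexp]
    field_simp
    ring
  set A : ℝ := ∫ x, |u x| ^ pexp N α with hA
  have hA0 : 0 ≤ A := integral_nonneg fun _ => by positivity
  have hF0 : 0 ≤ ∫ x, wOp α u x ^ 2 := integral_nonneg fun _ => sq_nonneg _
  have hreg : ∀ ε : ℝ, 0 < ε →
      A ^ (((N : ℝ) - 2 + α) / N) ≤ K * -∫ x, ψ x * regOp α ε u x := by
    intro ε hε
    have h1 := hckn ε hε v hv hvs
    simp_rw [hvp] at h1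
    have h2 := integral_sq_grad_le_neg_integral_regOp (α := α) hε hs0 hu hus
    have h3 : ∀ x, (‖x‖ ^ 2 + ε) ^ (α / 2) * ‖fderiv ℝ v x‖ ^ 2 =
        ((s + 2) / 2) ^ 2 * ((‖x‖ ^ 2 + ε) ^ (α / 2) * (|u x| ^ s * ‖fderiv ℝ u x‖ ^ 2)) := by
      intro x
      rw [sq_norm_fderiv_abs_rpow (hu1.differentiable one_ne_zero) hs0]
      ring
    simp_rw [h3] at h1
    rw [integral_const_mul] at h1
    refine h1.trans ?_
    calc _ = K * ((s + 1) * ∫ x, (‖x‖ ^ 2 + ε) ^ (α / 2) * (|u x| ^ s * ‖fderiv ℝ u x‖ ^ 2)) := by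
          rw [hK]; field_simp
      _ ≤ _ := by gcongr
  have hlim : A ^ (((N : ℝ) - 2 + α) / N) ≤ K * -∫ x, ψ x * wOp α u x := by
    have ht := tendsto_integral_mul_regOp hN hα1 hα2 hu hus hψ hψs
      (ε := fun n : ℕ => 1 / ((n : ℝ) + 1)) (fun n => by positivity)
      (fun n => by
        rw [div_le_one (by positivity)]
        linarith [n.cast_nonneg (α := ℝ)])
      tendsto_one_div_add_atTop_nhds_zero_nat
    exact ge_of_tendsto' (ht.neg.const_mul K) fun n => hreg _ (by positivity)
  have hw2 : MemLp (wOp α u) 2 volume :=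
    (memLp_opMajorant hN hα1 hu hus).mono' (measurable_wOp hu).aestronglyMeasurable
      (Eventually.of_forall fun x => norm_wOp_le hα1 x)
  have hψ2 : MemLp ψ 2 volume := hψ.memLp_of_hasCompactSupport hψs
  have hcs : -∫ x, ψ x * wOp α u x ≤
      A ^ (1 / 2 : ℝ) * (∫ x, wOp α u x ^ 2) ^ (1 / 2 : ℝ) := by
    have h1 := integral_mul_norm_le_Lp_mul_Lq (μ := volume) (f := ψ) (g := wOp α u)
      Real.HolderConjugate.two_two (by simpa using hψ2) (by simpa using hw2)
    simp_rw [hψp] at h1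
    have h2 : ∀ x, ‖wOp α u x‖ ^ (2 : ℝ) = wOp α u x ^ 2 := fun x => by simp
    simp_rw [h2] at h1
    refine le_trans ?_ h1
    simp_rw [← norm_mul]
    exact (neg_le_abs _).trans
      ((Real.norm_eq_abs _).symm.le.trans (norm_integral_le_integral_norm _))
  have hfin := rpow_le_of_rpow_le_mul_sqrt (θ := ((N : ℝ) - 4 + 2 * α) / N) (K := K) hA0 hF0
    (by positivity) (by
      have e : ((N : ℝ) - 4 + 2 * α) / N / 2 + 1 / 2 = ((N : ℝ) - 2 + α) / N := by
        field_simp; ring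
      rw [e]
      exact hlim.trans (by gcongr))
  rw [ge_iff_le, inv_mul_le_iff₀ (by positivity)]
  exact hfin

end
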